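/- For n ≥ 4 and 3 ≤ r ≤ n−1, the rank of ORD(n,r) equals C(n,r) + n + r − 5, and the rank of ORD_n equals 3n − 5. -/

import Mathlib

open Finset

namespace ORDPaper

/-- `f` is a full transformation of the chain `{1,…,n}`, acting as the identity outside. -/
def IsTrans (n : ℕ) (f : ℕ → ℕ) : Prop :=
  (∀ x, 1 ≤ x → x ≤ n → 1 ≤ f x ∧ f x ≤ n) ∧ ∀ x, ¬(1 ≤ x ∧ x ≤ n) → f x = x

/-- Composition of transformations, written left to right: `x(αβ) = (xα)β`. -/
def comp (f g : ℕ → ℕ) : ℕ → ℕ := fun x => g (f x)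

/-- The value of `f` at the cyclic successor of `i` (so `(n+1)α = 1α`). -/
def nxt (n : ℕ) (f : ℕ → ℕ) (i : ℕ) : ℕ := if i = n then f 1 else f (i + 1)

/-- `(1α,…,nα)` is cyclic: there is at most one descent (cyclically). -/
def Cyclic (n : ℕ) (f : ℕ → ℕ) : Prop :=
  ((Finset.Icc 1 n).filter (fun i => nxt n f i < f i)).card ≤ 1

/-- `(1α,…,nα)` is anti-cyclic: there is at most one ascent (cyclically). -/
def AntiCyclic (n : ℕ) (f : ℕ → ℕ) : Prop :=
  ((Finset.Icc 1 n).filter (fun i => f i < nxt n f i)).card ≤ 1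

/-- Order-decreasing on `{1,…,n}`. -/
def Decreasing (n : ℕ) (f : ℕ → ℕ) : Prop := ∀ x, 1 ≤ x → x ≤ n → f x ≤ x

/-- Image of `{1,…,n}` under `f`. -/
def im (n : ℕ) (f : ℕ → ℕ) : Finset ℕ := (Finset.Icc 1 n).image f

/-- Fixed points of `f` in `{1,…,n}`. -/
def fixSet (n : ℕ) (f : ℕ → ℕ) : Finset ℕ := (Finset.Icc 1 n).filter (fun x => f x = x)

/-- The semigroup `D_n` of order-decreasing full transformations. -/
def Dn (n : ℕ) : Set (ℕ → ℕ) := {f | IsTrans n f ∧ Decreasing n f}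

/-- Orientation-preserving order-decreasing transformations. -/
def OPD (n : ℕ) : Set (ℕ → ℕ) := {f | f ∈ Dn n ∧ Cyclic n f}

/-- Oriented order-decreasing transformations. -/
def ORDn (n : ℕ) : Set (ℕ → ℕ) := {f | f ∈ Dn n ∧ (Cyclic n f ∨ AntiCyclic n f)}

/-- `RD*_n`: orientation-reversing, order-decreasing, not orientation-preserving. -/
def RDstar (n : ℕ) : Set (ℕ → ℕ) := {f | f ∈ Dn n ∧ AntiCyclic n f ∧ ¬ Cyclic n f}

/-- `ORD(n,r)`. -/
def ORDr (n r : ℕ) : Set (ℕ → ℕ) := {f | f ∈ ORDn n ∧ (im n f).card ≤ r}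

/-- `OPD(n,r)`. -/
def OPDr (n r : ℕ) : Set (ℕ → ℕ) := {f | f ∈ OPD n ∧ (im n f).card ≤ r}

/-- The order-reversing degree: `min(X_n \ 1α⁻¹)`. -/
noncomputable def ordDeg (n : ℕ) (f : ℕ → ℕ) : ℕ := sInf {x | 1 ≤ x ∧ x ≤ n ∧ f x ≠ 1}

/-- Minimum of the preimage of `x` under `f` inside `{1,…,n}`. -/
noncomputable def preMin (n : ℕ) (f : ℕ → ℕ) (x : ℕ) : ℕ := sInf {y | 1 ≤ y ∧ y ≤ n ∧ f y = x}

/-- Membership in the subsemigroup generated by `A`. -/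
inductive gen (A : Set (ℕ → ℕ)) : (ℕ → ℕ) → Prop
  | base {f} : f ∈ A → gen A f
  | mul {f g} : gen A f → gen A g → gen A (comp f g)

/-- Rank of a transformation semigroup `S`. -/
noncomputable def rank (S : Set (ℕ → ℕ)) : ℕ :=
  sInf {k | ∃ A : Set (ℕ → ℕ), A ⊆ S ∧ A.Finite ∧ A.ncard = k ∧ {f | gen A f} = S}

/-- `r̂ = min{r, ⌈(n+1)/2⌉}`. -/
def rhat (n r : ℕ) : ℕ := min r ((n + 2) / 2)

/-- `ρ_m` fixes `1,…,m` and sends `m+1,…,n` to `1`. -/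
def rho (n m : ℕ) : ℕ → ℕ := fun x =>
  if ¬(1 ≤ x ∧ x ≤ n) then x else if x ≤ m then x else 1

/-- The order-preserving degree `opd(α) = max{m : α|_{X_m} is order-preserving}`. -/
noncomputable def opd (n : ℕ) (f : ℕ → ℕ) : ℕ :=
  sSup {m | m ≤ n ∧ ∀ x y, 1 ≤ x → x ≤ y → y ≤ m → f x ≤ f y}

/-- The set `C = (⋃_{m=r+1}^n B_m) ∪ {ρ_2,…,ρ_r}`. -/
def Cset (n r : ℕ) : Set (ℕ → ℕ) :=
  {f | (f ∈ OPD n ∧ comp f f = f ∧ (im n f).card = r ∧ r + 1 ≤ opd n f ∧ opd n f ≤ n)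
    ∨ (∃ m, 2 ≤ m ∧ m ≤ r ∧ f = rho n m)}

/-- The map `λ_{m,r}`: sends `[1,m-1]` to `1`, maps `x ∈ [m, min(2m-p-2,n)]` to `2m-x`
(where `p = max{0, m-r}` is `m - r` in truncated subtraction), and the rest of `[1,n]` to `1`. -/
def lam (n r m : ℕ) : ℕ → ℕ := fun x =>
  if ¬(1 ≤ x ∧ x ≤ n) then x
  else if x < m then 1
  else if x ≤ min (2 * m - (m - r) - 2) n then 2 * m - x
  else 1

/-- `G_{n,r} = {λ_{m,r} : 3 ≤ m ≤ n-1}`. -/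
def Gset (n r : ℕ) : Set (ℕ → ℕ) := {f | ∃ m, 3 ≤ m ∧ m ≤ n - 1 ∧ f = lam n r m}

/-- `L_{m,r}`. -/
def Lset (n r m : ℕ) : Set (ℕ → ℕ) :=
  {f | f ∈ ORDn n ∧ im n f = im n (lam n r m) ∧
    ∀ x ∈ im n (lam n r m), preMin n f x = preMin n (lam n r m) x}

/-- `α_{m,r}`: the idempotent fixing `{1} ∪ [m, 2m-p-2]` and sending the rest of `[1,n]` to `1`. -/
def alphaMap (n r m : ℕ) : ℕ → ℕ := fun x =>
  if ¬(1 ≤ x ∧ x ≤ n) then x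
  else if x < m then 1
  else if x ≤ 2 * m - (m - r) - 2 then x
  else 1

/-- `β_{m,r}`: sends `[1,m-1]` to `1`, maps `m,…,2m-p-3` order-reversingly to `m,…,p+3`,
and `[2m-p-2, n]` to `p+2`. -/
def betaMap (n r m : ℕ) : ℕ → ℕ := fun x =>
  if ¬(1 ≤ x ∧ x ≤ n) then x
  else if x < m then 1
  else if x ≤ 2 * m - (m - r) - 3 then 2 * m - x
  else (m - r) + 2

/-- `S` is a subsemigroup of `T`. -/
def IsSubsemigroupOf (S T : Set (ℕ → ℕ)) : Prop :=
  S ⊆ T ∧ ∀ f ∈ S, ∀ g ∈ S, comp f g ∈ S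

/-- `S` is a maximal subsemigroup of `T`. -/
def IsMaximalSubsemigroupOf (S T : Set (ℕ → ℕ)) : Prop :=
  IsSubsemigroupOf S T ∧ S ≠ T ∧ ∀ U, IsSubsemigroupOf U T → S ⊆ U → U = S ∨ U = T



/-- Elementary form of cyclicity for decreasing maps. -/
def Cy (n : ℕ) (f : ℕ → ℕ) : Prop :=
  ∀ x y z, 1 ≤ x → x ≤ y → y ≤ z → z ≤ n → f x ≤ f y ∨ f z = 1

/-- Elementary form of anti-cyclicity for decreasing maps. -/
def An (n : ℕ) (f : ℕ → ℕ) : Prop :=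
  ∀ z x y, 1 ≤ z → z ≤ x → x ≤ y → y ≤ n → f y ≤ f x ∨ f z = 1

lemma Dn_bd {n : ℕ} {f : ℕ → ℕ} (hf : f ∈ Dn n) {x : ℕ} (h1 : 1 ≤ x) (h2 : x ≤ n) :
    1 ≤ f x ∧ f x ≤ x ∧ f x ≤ n :=
  ⟨(hf.1.1 x h1 h2).1, hf.2 x h1 h2, (hf.1.1 x h1 h2).2⟩

lemma Dn_one {n : ℕ} {f : ℕ → ℕ} (hf : f ∈ Dn n) (hn : 1 ≤ n) : f 1 = 1 := by
  have := Dn_bd hf le_rfl hn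
  omega

lemma Dn_ext {n : ℕ} {f g : ℕ → ℕ} (hf : f ∈ Dn n) (hg : g ∈ Dn n)
    (h : ∀ x, 1 ≤ x → x ≤ n → f x = g x) : f = g := by
  funext x
  by_cases hx : 1 ≤ x ∧ x ≤ n
  · exact h x hx.1 hx.2
  · rw [hf.1.2 x hx, hg.1.2 x hx]

lemma mono_of_step {f : ℕ → ℕ} {a b : ℕ} (hab : a ≤ b)
    (h : ∀ i, a ≤ i → i < b → f i ≤ f (i + 1)) : f a ≤ f b := by
  induction b, hab using Nat.le_induction with
  | base => exact le_rfl
  | succ k hk ih =>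
    exact (ih fun i hi hik => h i hi (by omega)).trans (h k hk (by omega))

lemma anti_of_step {f : ℕ → ℕ} {a b : ℕ} (hab : a ≤ b)
    (h : ∀ i, a ≤ i → i < b → f (i + 1) ≤ f i) : f b ≤ f a := by
  induction b, hab using Nat.le_induction with
  | base => exact le_rfl
  | succ k hk ih =>
    exact (h k hk (by omega)).trans (ih fun i hi hik => h i hi (by omega))

lemma nxt_lt {n i : ℕ} (f : ℕ → ℕ) (h : i < n) : nxt n f i = f (i + 1) := by
  simp [nxt, Nat.ne_of_lt h]

lemma nxt_n (n : ℕ) (f : ℕ → ℕ) : nxt n f n = f 1 := by simp [nxt]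

lemma cyclic_iff {n : ℕ} {f : ℕ → ℕ} (hf : f ∈ Dn n) (hn : 1 ≤ n) : Cyclic n f ↔ Cy n f := by
  have h1 := Dn_one hf hn
  unfold Cyclic
  rw [Finset.card_le_one]
  simp only [Finset.mem_filter, Finset.mem_Icc]
  constructor
  · intro h x y z hx hxy hyz hz
    by_contra! hc
    have : ∃ i, x ≤ i ∧ i < y ∧ f (i + 1) < f i := by
      by_contra! hcc
      have := mono_of_step hxy hcc
      omega
    obtain ⟨i, hi1, hi2, hi3⟩ := this
    have hi : (1 ≤ i ∧ i ≤ n) ∧ nxt n f i < f i := by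
      rw [nxt_lt f (by omega)]
      omega
    have key : ∀ j, i < j → j ≤ n → f j ≤ nxt n f j := by
      intro j hj hjn
      by_contra! hcc
      have := h i hi j ⟨⟨by omega, hjn⟩, hcc⟩
      omega
    have h2 : f z ≤ f n := mono_of_step hz fun j hj hjn => by
      have := key j (by omega) (by omega)
      rwa [nxt_lt f hjn] at this
    have h3 := key n (by omega) le_rfl
    rw [nxt_n] at h3
    have := Dn_bd hf (x := z) (by omega) hz
    omega
  · intro h
    have key : ∀ i j, (1 ≤ i ∧ i ≤ n) ∧ nxt n f i < f i → (1 ≤ j ∧ j ≤ n) ∧ nxt n f j < f j →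
        ¬ i < j := by
      intro i j hi hj hij
      rw [nxt_lt f (by omega)] at hi
      have := h i (i + 1) j (by omega) (by omega) (by omega) (by omega)
      have h3 : 1 ≤ nxt n f j := by
        unfold nxt
        split_ifs
        · omega
        · exact (Dn_bd hf (by omega) (by omega)).1
      omega
    intro i hi j hj
    have := key i j hi hj
    have := key j i hj hi
    omega

lemma anti_iff {n : ℕ} {f : ℕ → ℕ} (hf : f ∈ Dn n) (hn : 1 ≤ n) : AntiCyclic n f ↔ An n f := by
  have h1 := Dn_one hf hn
  unfold AntiCyclic
  rw [Finset.card_le_one]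
  simp only [Finset.mem_filter, Finset.mem_Icc]
  constructor
  · intro h z x y hz hzx hxy hy
    by_contra! hc
    have : ∃ i, x ≤ i ∧ i < y ∧ f i < f (i + 1) := by
      by_contra! hcc
      have := anti_of_step hxy hcc
      omega
    obtain ⟨i, hi1, hi2, hi3⟩ := this
    have hi : (1 ≤ i ∧ i ≤ n) ∧ f i < nxt n f i := by
      rw [nxt_lt f (by omega)]
      omega
    have h2 : f z ≤ f 1 := anti_of_step hz fun j hj hjn => by
      by_contra! hcc
      have := h i hi j ⟨⟨by omega, by omega⟩, by rwa [nxt_lt f (by omega)]⟩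
      omega
    have := Dn_bd hf (x := z) (by omega) (by omega)
    omega
  · intro h
    have key : ∀ i j, (1 ≤ i ∧ i ≤ n) ∧ f i < nxt n f i → (1 ≤ j ∧ j ≤ n) ∧ f j < nxt n f j →
        ¬ i < j := by
      intro i j hi hj hij
      rw [nxt_lt f (by omega)] at hi
      have hb := Dn_bd hf (x := j) (by omega) (by omega)
      have hbi := Dn_bd hf (x := i) (by omega) (by omega)
      by_cases hjn : j = n
      · subst hjn
        rw [nxt_n] at hj
        omega
      · rw [nxt_lt f (by omega)] at hj
        have := h (i + 1) j (j + 1) (by omega) (by omega) (by omega) (by omega)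
        omega
    intro i hi j hj
    have := key i j hi hj
    have := key j i hj hi
    omega

lemma mem_ORDn {n : ℕ} (hn : 1 ≤ n) {f : ℕ → ℕ} :
    f ∈ ORDn n ↔ f ∈ Dn n ∧ (Cy n f ∨ An n f) := by
  constructor
  · rintro ⟨h, h'⟩
    rw [cyclic_iff h hn, anti_iff h hn] at h'
    exact ⟨h, h'⟩
  · rintro ⟨h, h'⟩
    rw [← cyclic_iff h hn, ← anti_iff h hn] at h'
    exact ⟨h, h'⟩

lemma Dn_comp {n : ℕ} {f g : ℕ → ℕ} (hf : f ∈ Dn n) (hg : g ∈ Dn n) : comp f g ∈ Dn n := by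
  refine ⟨⟨fun x h1 h2 => ?_, fun x hx => ?_⟩, fun x h1 h2 => ?_⟩
  · have := Dn_bd hf h1 h2
    have := Dn_bd hg this.1 this.2.2
    simp only [comp]; omega
  · simp only [comp]
    rw [hf.1.2 x hx, hg.1.2 x hx]
  · have := Dn_bd hf h1 h2
    have := Dn_bd hg this.1 this.2.2
    simp only [comp]; omega

lemma ORDn_comp {n : ℕ} (hn : 1 ≤ n) {f g : ℕ → ℕ} (hf : f ∈ ORDn n) (hg : g ∈ ORDn n) :
    comp f g ∈ ORDn n := by
  rw [mem_ORDn hn] at *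
  obtain ⟨hf, hf'⟩ := hf
  obtain ⟨hg, hg'⟩ := hg
  refine ⟨Dn_comp hf hg, ?_⟩
  have f1 := Dn_one hf hn
  have g1 := Dn_one hg hn
  have bf : ∀ x, 1 ≤ x → x ≤ n → 1 ≤ f x ∧ f x ≤ n := hf.1.1
  have bg : ∀ x, 1 ≤ x → x ≤ n → 1 ≤ g x ∧ g x ≤ n := hg.1.1
  rcases hf' with hf' | hf' <;> rcases hg' with hg' | hg'
  · left
    intro x y z hx hxy hyz hz
    simp only [comp]
    have b1 := bf x (by omega) (by omega)
    have b2 := bf y (by omega) (by omega)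
    have b3 := bf z (by omega) (by omega)
    rcases hf' x y z hx hxy hyz hz with h | h
    · rcases hf' y z z (by omega) hyz le_rfl hz with h' | h'
      · exact hg' (f x) (f y) (f z) b1.1 h h' b3.2
      · right; rw [h', g1]
    · right; rw [h, g1]
  · right
    intro z x y hz hzx hxy hy
    simp only [comp]
    have b1 := bf x (by omega) (by omega)
    have b2 := bf y (by omega) (by omega)
    have b3 := bf z (by omega) (by omega)
    have c1 := bg _ b1.1 b1.2
    rcases hf' x y y (by omega) hxy le_rfl hy with h | h
    · rcases hf' z x x (by omega) hzx le_rfl (by omega) with h' | h'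
      · exact hg' (f z) (f x) (f y) b3.1 h' h b2.2
      · rcases hf' z x y hz hzx hxy hy with h2 | h2
        · exact hg' (f z) (f x) (f y) b3.1 h2 h b2.2
        · left; rw [h2, g1]; exact c1.1
    · left; rw [h, g1]; exact c1.1
  · right
    intro z x y hz hzx hxy hy
    simp only [comp]
    have b1 := bf x (by omega) (by omega)
    have b2 := bf y (by omega) (by omega)
    have b3 := bf z (by omega) (by omega)
    rcases hf' z x y hz hzx hxy hy with h | h
    · rcases hf' z z x hz le_rfl hzx (by omega) with h' | h'
      · exact hg' (f y) (f x) (f z) b2.1 h h' b3.2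
      · right; rw [h', g1]
    · right; rw [h, g1]
  · left
    intro x y z hx hxy hyz hz
    simp only [comp]
    have b1 := bf x (by omega) (by omega)
    have b2 := bf y (by omega) (by omega)
    have b3 := bf z (by omega) (by omega)
    have c2 := bg _ b2.1 b2.2
    rcases hf' x x y hx le_rfl hxy (by omega) with h | h
    · rcases hf' x y z (by omega) hxy hyz hz with h' | h'
      · exact hg' (f z) (f y) (f x) b3.1 h' h b1.2
      · left; rw [h', g1]; exact c2.1
    · left; rw [h, g1]; exact c2.1

lemma im_comp_card (n : ℕ) (f g : ℕ → ℕ) : (im n (comp f g)).card ≤ (im n f).card := by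
  have : im n (comp f g) = (im n f).image g := by
    simp only [im, Finset.image_image]; rfl
  rw [this]
  exact Finset.card_image_le

lemma ORDr_comp {n r : ℕ} (hn : 1 ≤ n) {f g : ℕ → ℕ} (hf : f ∈ ORDr n r) (hg : g ∈ ORDr n r) :
    comp f g ∈ ORDr n r :=
  ⟨ORDn_comp hn hf.1 hg.1, (im_comp_card n f g).trans hf.2⟩

lemma mem_im {n : ℕ} {f : ℕ → ℕ} {v : ℕ} : v ∈ im n f ↔ ∃ x, (1 ≤ x ∧ x ≤ n) ∧ f x = v := by
  simp [im]

lemma gen_sub {A S : Set (ℕ → ℕ)} (hA : A ⊆ S) (hS : ∀ f ∈ S, ∀ g ∈ S, comp f g ∈ S)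
    {f : ℕ → ℕ} (h : gen A f) : f ∈ S := by
  induction h with
  | base h => exact hA h
  | mul _ _ h1 h2 => exact hS _ h1 _ h2

lemma gen_mono {A B : Set (ℕ → ℕ)} (hA : A ⊆ B) {f : ℕ → ℕ} (h : gen A f) : gen B f := by
  induction h with
  | base h => exact gen.base (hA h)
  | mul _ _ h1 h2 => exact gen.mul h1 h2

lemma gen_hit {A S : Set (ℕ → ℕ)} (hA : A ⊆ S) (hS : ∀ f ∈ S, ∀ g ∈ S, comp f g ∈ S)
    (P : (ℕ → ℕ) → Prop) (hP : ∀ f ∈ S, ∀ g ∈ S, P (comp f g) → P f ∨ P g)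
    {f : ℕ → ℕ} (h : gen A f) : P f → ∃ a ∈ A, P a := by
  induction h with
  | base h => exact fun hp => ⟨_, h, hp⟩
  | mul h1 h2 i1 i2 =>
    intro hp
    rcases hP _ (gen_sub hA hS h1) _ (gen_sub hA hS h2) hp with h | h
    · exact i1 h
    · exact i2 h

/-- Idempotent with image `A` and cutoff `m`. -/
def ee (n : ℕ) (A : Finset ℕ) (m : ℕ) : ℕ → ℕ := fun x =>
  if ¬(1 ≤ x ∧ x ≤ n) then x else if x ≤ m then (A.filter (· ≤ x)).sup id else 1

/-- Admissible data for `ee`. -/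
def Val (n : ℕ) (A : Finset ℕ) (m : ℕ) : Prop :=
  1 ∈ A ∧ (∀ a ∈ A, 1 ≤ a ∧ a ≤ m) ∧ m ≤ n

lemma ee_spec {n m : ℕ} {A : Finset ℕ} (h : Val n A m) {x : ℕ} (h1 : 1 ≤ x) (h2 : x ≤ m) :
    ee n A m x ∈ A ∧ ee n A m x ≤ x ∧ ∀ a ∈ A, a ≤ x → a ≤ ee n A m x := by
  have hmn := h.2.2
  have e : ee n A m x = (A.filter (· ≤ x)).sup id := by
    unfold ee
    rw [if_neg (by omega), if_pos h2]
  have hne : (A.filter (· ≤ x)).Nonempty := ⟨1, by simp [h.1, h1]⟩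
  obtain ⟨b, hb, hb'⟩ := Finset.exists_mem_eq_sup _ hne id
  rw [e, hb']
  simp only [Finset.mem_filter] at hb
  refine ⟨hb.1, hb.2, fun a ha hax => ?_⟩
  rw [← hb']
  exact Finset.le_sup (f := id) (by simp [ha, hax])

lemma ee_gt {n m : ℕ} {A : Finset ℕ} {x : ℕ} (h1 : 1 ≤ x) (h2 : m < x) (h3 : x ≤ n) :
    ee n A m x = 1 := by
  unfold ee
  rw [if_neg (by omega), if_neg (by omega)]

lemma ee_out {n m : ℕ} {A : Finset ℕ} {x : ℕ} (h1 : ¬ (1 ≤ x ∧ x ≤ n)) :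
    ee n A m x = x := by
  unfold ee
  rw [if_pos h1]

lemma ee_eq {n m : ℕ} {A : Finset ℕ} (h : Val n A m) {x y : ℕ} (h1 : 1 ≤ x) (h2 : x ≤ m)
    (hy : y ∈ A) (hyx : y ≤ x) (hm : ∀ a ∈ A, a ≤ x → a ≤ y) : ee n A m x = y := by
  obtain ⟨e1, e2, e3⟩ := ee_spec h h1 h2
  exact le_antisymm (hm _ e1 e2) (e3 _ hy hyx)

lemma ee_fix {n m : ℕ} {A : Finset ℕ} (h : Val n A m) {x : ℕ} (hx : x ∈ A) : ee n A m x = x :=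
  ee_eq h (h.2.1 x hx).1 (h.2.1 x hx).2 hx le_rfl fun _ _ h => h

lemma ee_Dn {n m : ℕ} {A : Finset ℕ} (h : Val n A m) : ee n A m ∈ Dn n := by
  have key : ∀ x, 1 ≤ x → x ≤ n → 1 ≤ ee n A m x ∧ ee n A m x ≤ x := by
    intro x h1 h2
    by_cases hx : x ≤ m
    · obtain ⟨e1, e2, e3⟩ := ee_spec h h1 hx
      exact ⟨(h.2.1 _ e1).1, e2⟩
    · rw [ee_gt h1 (by omega) h2]
      omega
  refine ⟨⟨fun x h1 h2 => ?_, fun x hx => ee_out hx⟩, fun x h1 h2 => (key x h1 h2).2⟩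
  have := key x h1 h2
  omega

lemma ee_Cy {n m : ℕ} {A : Finset ℕ} (h : Val n A m) : Cy n (ee n A m) := by
  intro x y z hx hxy hyz hz
  by_cases hm : z ≤ m
  · left
    obtain ⟨e1, e2, e3⟩ := ee_spec h hx (x := x) (by omega)
    exact (ee_spec h (x := y) (by omega) (by omega)).2.2 _ e1 (by omega)
  · right
    exact ee_gt (by omega) (by omega) hz

lemma ee_im {n m : ℕ} {A : Finset ℕ} (h : Val n A m) : im n (ee n A m) = A := by
  have hmn := h.2.2
  ext v
  rw [mem_im]
  constructor
  · rintro ⟨x, ⟨h1, h2⟩, rfl⟩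
    by_cases hx : x ≤ m
    · exact (ee_spec h h1 hx).1
    · rw [ee_gt h1 (by omega) h2]
      exact h.1
  · intro hv
    have := h.2.1 v hv
    exact ⟨v, by omega, ee_fix h hv⟩

lemma ee_ORDr {n m r : ℕ} (hn : 1 ≤ n) {A : Finset ℕ} (h : Val n A m) (hr : A.card ≤ r) :
    ee n A m ∈ ORDr n r :=
  ⟨(mem_ORDn hn).2 ⟨ee_Dn h, Or.inl (ee_Cy h)⟩, by rwa [ee_im h]⟩

lemma ee_idem {n m : ℕ} {A : Finset ℕ} (h : Val n A m) {x : ℕ} (h1 : 1 ≤ x) (h2 : x ≤ n) :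
    ee n A m (ee n A m x) = ee n A m x := by
  apply ee_fix h
  have h3 : ee n A m x ∈ im n (ee n A m) := mem_im.2 ⟨x, ⟨h1, h2⟩, rfl⟩
  rwa [ee_im h] at h3

/-- The generating set. -/
def Gs (n r : ℕ) : Set (ℕ → ℕ) :=
  {f | (∃ A m, Val n A m ∧ A.card = r ∧ f = ee n A m) ∨
    (∃ k, 2 ≤ k ∧ k < r ∧ f = ee n (Finset.Icc 1 k) k) ∨
    (∃ m, 3 ≤ m ∧ m ≤ n - 1 ∧ f = lam n r m)}

lemma Val_Icc {n k : ℕ} (h1 : 1 ≤ k) (h : k ≤ n) : Val n (Finset.Icc 1 k) k :=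
  ⟨by simp [h1], by simp, h⟩

lemma Val_insert {n m c : ℕ} {A : Finset ℕ} (h : Val n A m) (h1 : 1 ≤ c) (h2 : c ≤ m) :
    Val n (insert c A) m := by
  refine ⟨by simp [h.1], ?_, h.2.2⟩
  intro a ha
  rcases Finset.mem_insert.1 ha with rfl | ha
  · exact ⟨h1, h2⟩
  · exact h.2.1 a ha

lemma Val_mono {n m m' : ℕ} {A : Finset ℕ} (h : Val n A m) (h1 : m ≤ m') (h2 : m' ≤ n) :
    Val n A m' :=
  ⟨h.1, fun a ha => ⟨(h.2.1 a ha).1, (h.2.1 a ha).2.trans h1⟩, h2⟩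

lemma ee_split {n m c d : ℕ} {A : Finset ℕ} (h : Val n A m) (hc1 : 1 ≤ c)
    (hcd : c < d) (hdm : d ≤ m) (hc : c ∉ A) (hd : d ∉ A) :
    ee n A m = comp (ee n (insert c A) m) (ee n (insert d A) m) := by
  have hmn := h.2.2
  have vc : Val n (insert c A) m := Val_insert h hc1 (by omega)
  have vd : Val n (insert d A) m := Val_insert h (by omega) hdm
  refine Dn_ext (ee_Dn h) (Dn_comp (ee_Dn vc) (ee_Dn vd)) fun x h1 h2 => ?_
  simp only [comp]
  by_cases hx : x ≤ m
  · obtain ⟨e1, e2, e3⟩ := ee_spec vc h1 hx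
    set y := ee n (insert c A) m x with hy
    rcases Finset.mem_insert.1 e1 with hyc | hyA
    · obtain ⟨p1, p2, p3⟩ := ee_spec h (x := c) hc1 (by omega)
      rw [hyc, ee_eq vd hc1 (by omega) (y := ee n A m c) (by simp [p1]) p2]
      · refine ee_eq h h1 hx p1 (by omega) fun a ha hax => p3 a ha ?_
        have := e3 a (by simp [ha]) hax
        omega
      · intro a ha hac
        rcases Finset.mem_insert.1 ha with rfl | ha
        · omega
        · exact p3 a ha hac
    · rw [ee_fix vd (by simp [hyA])]
      exact ee_eq h h1 hx hyA e2 fun a ha hax => e3 a (by simp [ha]) hax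
  · rw [ee_gt h1 (by omega) h2, ee_gt h1 (by omega) h2, ee_fix vd vd.1]

lemma ee_gen {n r : ℕ} (hn : 4 ≤ n) (hr : 3 ≤ r) (hrn : r ≤ n - 1) (d : ℕ) :
    ∀ (A : Finset ℕ) (m : ℕ), A.card + d = r → Val n A m → gen (Gs n r) (ee n A m) := by
  induction d with
  | zero =>
    intro A m hA hv
    exact gen.base (Or.inl ⟨A, m, hv, by simpa using hA, rfl⟩)
  | succ d ih =>
    have two : ∀ (A : Finset ℕ) (m c e : ℕ), A.card + (d + 1) = r → Val n A m → 1 ≤ c → c < e →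
        e ≤ m → c ∉ A → e ∉ A → gen (Gs n r) (ee n A m) := by
      intro A m c e hA hv h1 hce hem hc he
      rw [ee_split hv h1 hce hem hc he]
      refine gen.mul (ih _ _ ?_ (Val_insert hv h1 (by omega)))
        (ih _ _ ?_ (Val_insert hv (by omega) hem))
      · rw [Finset.card_insert_of_notMem hc]; omega
      · rw [Finset.card_insert_of_notMem he]; omega
    intro A m hA hv
    have hmn := hv.2.2
    have h1m : 1 ≤ m := (hv.2.1 1 hv.1).2
    by_cases hA1 : A = {1}
    · subst hA1
      have v' : Val n {1} n := Val_mono hv hmn le_rfl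
      have : ee n {1} m = ee n {1} n := by
        refine Dn_ext (ee_Dn hv) (ee_Dn v') fun x h1 h2 => ?_
        rw [Finset.mem_singleton.1 (ee_spec v' h1 h2).1]
        by_cases hx : x ≤ m
        · exact Finset.mem_singleton.1 (ee_spec hv h1 hx).1
        · exact ee_gt h1 (by omega) h2
      rw [this]
      exact two _ n 2 3 hA v' (by omega) (by omega) (by omega) (by simp) (by simp)
    by_cases h2 : ∃ c e, 1 ≤ c ∧ c < e ∧ e ≤ m ∧ c ∉ A ∧ e ∉ A
    · obtain ⟨c, e, h1, hce, hem, hc, he⟩ := h2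
      exact two A m c e hA hv h1 hce hem hc he
    have hsub : A ⊆ Finset.Icc 1 m := fun a ha => Finset.mem_Icc.2 (hv.2.1 a ha)
    have hone : (Finset.Icc 1 m \ A).card ≤ 1 := by
      rw [Finset.card_le_one]
      intro a ha b hb
      simp only [Finset.mem_sdiff, Finset.mem_Icc] at ha hb
      by_contra hab
      rcases Nat.lt_or_gt_of_ne hab with h | h
      · exact h2 ⟨a, b, ha.1.1, h, hb.1.2, ha.2, hb.2⟩
      · exact h2 ⟨b, a, hb.1.1, h, ha.1.2, hb.2, ha.2⟩
    have hcard := Finset.card_sdiff_add_card_eq_card hsub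
    rw [Nat.card_Icc] at hcard
    by_cases h0 : (Finset.Icc 1 m \ A).card = 0
    · have hAm : A = Finset.Icc 1 m := by
        apply Finset.eq_of_subset_of_card_le hsub
        rw [Nat.card_Icc]; omega
      have hm1 : m ≠ 1 := by
        rintro rfl
        apply hA1
        simpa using hAm
      rw [hAm]
      exact gen.base (Or.inr (Or.inl ⟨m, by omega, by omega, rfl⟩))
    · have hm : m = A.card + 1 := by omega
      have hmA : m + 1 ∉ A := fun h => by have := (hv.2.1 _ h).2; omega
      have v1 : Val n (Finset.Icc 1 m) m := Val_Icc h1m hmn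
      have v2 : Val n (insert (m + 1) A) (m + 1) :=
        Val_insert (Val_mono hv (by omega) (by omega)) (by omega) le_rfl
      have : ee n A m = comp (ee n (Finset.Icc 1 m) m) (ee n (insert (m + 1) A) (m + 1)) := by
        refine Dn_ext (ee_Dn hv) (Dn_comp (ee_Dn v1) (ee_Dn v2)) fun x h1 h2 => ?_
        simp only [comp]
        by_cases hx : x ≤ m
        · rw [ee_fix v1 (x := x) (by simp [h1, hx])]
          obtain ⟨e1, e2, e3⟩ := ee_spec v2 (x := x) h1 (by omega)
          refine ee_eq hv h1 hx ?_ e2 fun a ha hax => e3 a (by simp [ha]) hax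
          rcases Finset.mem_insert.1 e1 with h | h
          · omega
          · exact h
        · rw [ee_gt h1 (by omega) h2, ee_gt h1 (by omega) h2, ee_fix v2 v2.1]
      rw [this]
      refine gen.mul (ih _ _ ?_ v1) (ih _ _ ?_ v2)
      · rw [Nat.card_Icc]; omega
      · rw [Finset.card_insert_of_notMem hmA]; omega


/-- Raise the value `c` of `f` to `c + 1`. -/
def rs (n : ℕ) (f : ℕ → ℕ) (c : ℕ) : ℕ → ℕ := fun x =>
  if (1 ≤ x ∧ x ≤ n) ∧ f x = c then c + 1 else f x

lemma rs_val {n c : ℕ} (f : ℕ → ℕ) {x : ℕ} (h1 : 1 ≤ x) (h2 : x ≤ n) :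
    (f x = c ∧ rs n f c x = c + 1) ∨ (f x ≠ c ∧ rs n f c x = f x) := by
  unfold rs
  by_cases h : f x = c
  · left; exact ⟨h, if_pos ⟨⟨h1, h2⟩, h⟩⟩
  · right; exact ⟨h, if_neg fun h' => h h'.2⟩

lemma rs_Dn {n c : ℕ} {f : ℕ → ℕ} (hf : f ∈ Dn n)
    (h : ∀ x, 1 ≤ x → x ≤ n → f x = c → c + 1 ≤ x) : rs n f c ∈ Dn n := by
  refine ⟨⟨fun x h1 h2 => ?_, fun x hx => ?_⟩, fun x h1 h2 => ?_⟩
  · have := Dn_bd hf h1 h2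
    have := h x h1 h2
    rcases rs_val (c := c) f h1 h2 with h' | h' <;> omega
  · unfold rs
    rw [if_neg fun h' => hx h'.1, hf.1.2 x hx]
  · have := Dn_bd hf h1 h2
    have := h x h1 h2
    rcases rs_val (c := c) f h1 h2 with h' | h' <;> omega

lemma ne_of_notMem_im {n c : ℕ} {f : ℕ → ℕ} (h : c ∉ im n f) {x : ℕ} (h1 : 1 ≤ x) (h2 : x ≤ n) :
    f x ≠ c := fun h' => h (mem_im.2 ⟨x, ⟨h1, h2⟩, h'⟩)

lemma rs_Cy {n c : ℕ} {f : ℕ → ℕ} (hc : 2 ≤ c) (h : c + 1 ∉ im n f) (hf : Cy n f) :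
    Cy n (rs n f c) := by
  intro x y z hx hxy hyz hz
  have := hf x y z hx hxy hyz hz
  have := ne_of_notMem_im h (x := y) (by omega) (by omega)
  have := ne_of_notMem_im h (x := x) (by omega) (by omega)
  have h1 := rs_val (n := n) (c := c) f (x := x) (by omega) (by omega)
  have h2 := rs_val (n := n) (c := c) f (x := y) (by omega) (by omega)
  have h3 := rs_val (n := n) (c := c) f (x := z) (by omega) (by omega)
  omega

lemma rs_An {n c : ℕ} {f : ℕ → ℕ} (hc : 2 ≤ c) (h : c + 1 ∉ im n f) (hf : An n f) :
    An n (rs n f c) := by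
  intro z x y hz hzx hxy hy
  have := hf z x y hz hzx hxy hy
  have := ne_of_notMem_im h (x := y) (by omega) (by omega)
  have := ne_of_notMem_im h (x := x) (by omega) (by omega)
  have h1 := rs_val (n := n) (c := c) f (x := x) (by omega) (by omega)
  have h2 := rs_val (n := n) (c := c) f (x := y) (by omega) (by omega)
  have h3 := rs_val (n := n) (c := c) f (x := z) (by omega) (by omega)
  omega

lemma im_card_le_of {n : ℕ} {f g p : ℕ → ℕ} (h : ∀ x, 1 ≤ x → x ≤ n → g x = p (f x)) :
    (im n g).card ≤ (im n f).card := by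
  have : im n g ⊆ (im n f).image p := by
    intro v hv
    obtain ⟨x, ⟨h1, h2⟩, rfl⟩ := mem_im.1 hv
    rw [h x h1 h2]
    exact Finset.mem_image_of_mem _ (mem_im.2 ⟨x, ⟨h1, h2⟩, rfl⟩)
  exact (Finset.card_le_card this).trans Finset.card_image_le

lemma rs_card (n c : ℕ) (f : ℕ → ℕ) : (im n (rs n f c)).card ≤ (im n f).card := by
  apply im_card_le_of (p := fun v => if v = c then c + 1 else v)
  intro x h1 h2
  unfold rs
  simp [h1, h2]

lemma im_Val {n : ℕ} (hn : 1 ≤ n) {f : ℕ → ℕ} (hf : f ∈ Dn n) : Val n (im n f) n := by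
  refine ⟨mem_im.2 ⟨1, ⟨le_rfl, hn⟩, Dn_one hf hn⟩, fun a ha => ?_, le_rfl⟩
  obtain ⟨x, ⟨h1, h2⟩, rfl⟩ := mem_im.1 ha
  exact hf.1.1 x h1 h2

lemma rs_comp {n c : ℕ} (hn : 1 ≤ n) {f : ℕ → ℕ} (hf : f ∈ Dn n) (hcm : c ∈ im n f)
    (h : c + 1 ∉ im n f) (hd : ∀ x, 1 ≤ x → x ≤ n → f x = c → c + 1 ≤ x) :
    f = comp (rs n f c) (ee n (im n f) n) := by
  have hv := im_Val hn hf
  refine Dn_ext hf (Dn_comp (rs_Dn hf hd) (ee_Dn hv)) fun x h1 h2 => ?_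
  simp only [comp]
  have := hd x h1 h2
  rcases rs_val (c := c) f h1 h2 with h' | h'
  · rw [h'.2, h'.1]
    symm
    apply ee_eq hv (by omega) (by omega) hcm (by omega)
    intro a ha hac
    have : a ≠ c + 1 := fun h' => h (h' ▸ ha)
    omega
  · rw [h'.2, ee_fix hv (mem_im.2 ⟨x, ⟨h1, h2⟩, rfl⟩)]

lemma rs_sum {n c : ℕ} {f : ℕ → ℕ} (hcm : c ∈ im n f) :
    ∑ x ∈ Finset.Icc 1 n, f x < ∑ x ∈ Finset.Icc 1 n, rs n f c x := by
  apply Finset.sum_lt_sum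
  · intro x hx
    rw [Finset.mem_Icc] at hx
    have := rs_val (c := c) f hx.1 hx.2
    omega
  · obtain ⟨x, ⟨h1, h2⟩, h3⟩ := mem_im.1 hcm
    refine ⟨x, Finset.mem_Icc.2 ⟨h1, h2⟩, ?_⟩
    have := rs_val (c := c) f h1 h2
    omega

lemma sum_le {n : ℕ} {f : ℕ → ℕ} (hf : f ∈ Dn n) : ∑ x ∈ Finset.Icc 1 n, f x ≤ n * n := by
  have := Finset.sum_le_card_nsmul (Finset.Icc 1 n) f n fun x hx => by
    rw [Finset.mem_Icc] at hx
    exact (hf.1.1 x hx.1 hx.2).2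
  simpa using this

lemma raise_ind {n r : ℕ} (hn : 4 ≤ n) (hr : 3 ≤ r) (hrn : r ≤ n - 1) (Q : (ℕ → ℕ) → Prop)
    (hQ : ∀ f c, 2 ≤ c → c + 1 ∉ im n f → Q f → Q (rs n f c))
    (hb : ∀ f ∈ Dn n, Q f → (im n f).card ≤ r →
      (∀ c ∈ im n f, 2 ≤ c → c + 1 ∉ im n f → f c = c) → gen (Gs n r) f) :
    ∀ (k : ℕ) (f : ℕ → ℕ), n * n ≤ ∑ x ∈ Finset.Icc 1 n, f x + k → f ∈ Dn n → Q f →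
      (im n f).card ≤ r → gen (Gs n r) f := by
  intro k
  induction k with
  | zero =>
    intro f hk hf hq hc
    apply hb f hf hq hc
    intro c hcm h2 h3
    by_contra hcc
    have h4 : ∀ x, 1 ≤ x → x ≤ n → f x = c → c + 1 ≤ x := by
      intro x h1 h2 h5
      have := Dn_bd hf h1 h2
      by_contra h6
      have : x = c := by omega
      exact hcc (this ▸ h5)
    have := sum_le (rs_Dn hf h4)
    have := rs_sum hcm
    omega
  | succ k ih =>
    intro f hk hf hq hc
    by_cases hno : ∀ c ∈ im n f, 2 ≤ c → c + 1 ∉ im n f → f c = c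
    · exact hb f hf hq hc hno
    push Not at hno
    obtain ⟨c, hcm, h2, h3, hcc⟩ := hno
    have h4 : ∀ x, 1 ≤ x → x ≤ n → f x = c → c + 1 ≤ x := by
      intro x h1 h2 h5
      have := Dn_bd hf h1 h2
      by_contra h6
      have : x = c := by omega
      exact hcc (this ▸ h5)
    have := rs_sum hcm
    rw [rs_comp (by omega) hf hcm h3 h4]
    refine gen.mul (ih _ (by omega) (rs_Dn hf h4) (hQ f c h2 h3 hq)
      ((rs_card n c f).trans hc)) (ee_gen hn hr hrn (r - (im n f).card) _ _ (by omega)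
        (im_Val (by omega) hf))

lemma gen_Cy {n r : ℕ} (hn : 4 ≤ n) (hr : 3 ≤ r) (hrn : r ≤ n - 1) {f : ℕ → ℕ}
    (hf : f ∈ Dn n) (hq : Cy n f) (hc : (im n f).card ≤ r) : gen (Gs n r) f := by
  refine raise_ind hn hr hrn (Cy n) (fun f c => rs_Cy) ?_ (n * n) f (by omega) hf hq hc
  clear f hf hq hc
  intro f hf hq hc hno
  have f1 := Dn_one hf (by omega)
  have hid : ∀ d c, n ≤ c + d → c ∈ im n f → f c = c := by
    intro d
    induction d with
    | zero =>
      intro c h1 h2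
      apply hno c h2 (by omega)
      intro h3
      obtain ⟨x, ⟨p1, p2⟩, p3⟩ := mem_im.1 h3
      have := Dn_bd hf p1 p2
      omega
    | succ d ih =>
      intro c h1 h2
      obtain ⟨x, ⟨p1, p2⟩, p3⟩ := mem_im.1 h2
      have b := Dn_bd hf p1 p2
      by_cases hc1 : c = 1
      · rw [hc1, f1]
      by_cases h3 : c + 1 ∈ im n f
      · have h4 := ih (c + 1) (by omega) h3
        by_cases h5 : x = c
        · rw [← h5, p3, h5]
        · have := hq (c + 1) x x (by omega) (by omega) le_rfl p2
          omega
      · exact hno c h2 (by omega) h3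
  replace hid : ∀ c ∈ im n f, f c = c := fun c => hid n c (by omega)
  classical
  set m := Nat.findGreatest (fun x => f x ≠ 1 ∨ x = 1) n with hm
  have m1 : f m ≠ 1 ∨ m = 1 :=
    Nat.findGreatest_spec (P := fun x => f x ≠ 1 ∨ x = 1) (m := 1) (by omega) (Or.inr rfl)
  have m2 : ∀ x, m < x → x ≤ n → f x = 1 := by
    intro x h1 h2
    have := Nat.findGreatest_is_greatest h1 h2
    by_contra h3
    exact this (Or.inl h3)
  have m3 : m ≤ n := Nat.findGreatest_le n
  have m4 : 1 ≤ m := Nat.le_findGreatest (by omega) (Or.inr rfl)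
  have hv : Val n (im n f) m := by
    refine ⟨(im_Val (by omega) hf).1, fun a ha => ?_, m3⟩
    have h1 := (im_Val (by omega) hf).2.1 a ha
    refine ⟨h1.1, ?_⟩
    by_contra h2
    have := m2 a (by omega) h1.2
    have := hid a ha
    omega
  have : f = ee n (im n f) m := by
    refine Dn_ext hf (ee_Dn hv) fun x h1 h2 => ?_
    by_cases hx : x ≤ m
    · symm
      refine ee_eq hv h1 hx (mem_im.2 ⟨x, ⟨h1, h2⟩, rfl⟩) (hf.2 x h1 h2) fun a ha hax => ?_
      have h3 := hid a ha
      have h4 := hv.2.1 a ha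
      have := hq a x m h4.1 hax hx m3
      have := Dn_bd hf h1 h2
      rcases m1 with h | h
      · omega
      · omega
    · rw [ee_gt h1 (by omega) h2, m2 x (by omega) h2]
  rw [this]
  exact ee_gen hn hr hrn (r - (im n f).card) _ _ (by omega) hv

lemma gen_An {n r : ℕ} (hn : 4 ≤ n) (hr : 3 ≤ r) (hrn : r ≤ n - 1) {f : ℕ → ℕ}
    (hf : f ∈ Dn n) (hq : An n f) (hc : (im n f).card ≤ r) : gen (Gs n r) f := by
  refine raise_ind hn hr hrn (An n) (fun f c => rs_An) ?_ (n * n) f (by omega) hf hq hc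
  clear f hf hq hc
  intro f hf hq hc hno
  by_cases hcy : Cy n f
  · exact gen_Cy hn hr hrn hf hcy hc
  have f1 := Dn_one hf (by omega)
  have bd : ∀ x, 1 ≤ x → x ≤ n → 1 ≤ f x ∧ f x ≤ x ∧ f x ≤ n := fun x h1 h2 => Dn_bd hf h1 h2
  unfold Cy at hcy
  push Not at hcy
  obtain ⟨x0, y0, z0, hx0, hxy0, hyz0, hz0, hlt0, hne0⟩ := hcy
  classical
  have hex : ∃ x, 1 ≤ x ∧ x ≤ n ∧ f x ≠ 1 := ⟨z0, by omega, hz0, hne0⟩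
  set m := Nat.find hex with hm
  obtain ⟨m1, m2, m3⟩ : 1 ≤ m ∧ m ≤ n ∧ f m ≠ 1 := Nat.find_spec hex
  have m4 : ∀ x, 1 ≤ x → x ≤ n → f x ≠ 1 → m ≤ x := fun x h1 h2 h3 =>
    Nat.find_min' hex ⟨h1, h2, h3⟩
  have anti : ∀ x y, m ≤ x → x ≤ y → y ≤ n → f y ≤ f x := by
    intro x y h1 h2 h3
    rcases hq m x y m1 h1 h2 h3 with h | h
    · exact h
    · exact absurd h m3
  have bx := bd x0 (by omega) (by omega)
  have b_y := bd y0 (by omega) (by omega)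
  have bz := bd z0 (by omega) (by omega)
  have bm := bd m (by omega) (by omega)
  have mx : m ≤ x0 := m4 x0 (by omega) (by omega) (by omega)
  have a1 := anti y0 z0 (by omega) hyz0 hz0
  have a2 := anti m x0 le_rfl mx (by omega)
  have hm3 : 3 ≤ m := by omega
  have hmn : m ≤ n - 1 := by
    have : x0 ≠ y0 := fun h => by rw [h] at hlt0; omega
    omega
  have climb : ∀ c ∈ im n f, 2 ≤ c → c + 1 ∈ im n f ∨ c = m := by
    intro c h1 h2
    by_cases h3 : c + 1 ∈ im n f
    · exact Or.inl h3
    right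
    have h4 := hno c h1 h2 h3
    obtain ⟨x, ⟨p1, p2⟩, p3⟩ := mem_im.1 h1
    have b := bd x p1 p2
    have h5 := m4 c (by omega) (by omega) (by omega)
    have h6 := anti m c le_rfl h5 (by omega)
    omega
  have key : ∀ d x, 1 ≤ x → x ≤ n → 2 ≤ f x → f x + d = m →
      2 * m ≤ x + f x ∧ Finset.Icc (f x) m ⊆ im n f := by
    intro d
    induction d with
    | zero =>
      intro x h1 h2 h3 h4
      have := m4 x h1 h2 (by omega)
      refine ⟨by omega, ?_⟩
      have h5 : f x = m := by omega
      rw [h5, Finset.Icc_self, Finset.singleton_subset_iff]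
      exact mem_im.2 ⟨x, ⟨h1, h2⟩, h5⟩
    | succ d ih =>
      intro x h1 h2 h3 h4
      rcases climb (f x) (mem_im.2 ⟨x, ⟨h1, h2⟩, rfl⟩) h3 with h | h
      · obtain ⟨y, ⟨p1, p2⟩, p3⟩ := mem_im.1 h
        obtain ⟨i1, i2⟩ := ih y p1 p2 (by omega) (by omega)
        have q1 := m4 x h1 h2 (by omega)
        have q2 : y < x := by
          by_contra h5
          have := anti x y q1 (by omega) p2
          omega
        refine ⟨by omega, fun v hv => ?_⟩
        rw [Finset.mem_Icc] at hv
        by_cases h6 : v = f x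
        · exact mem_im.2 ⟨x, ⟨h1, h2⟩, h6.symm⟩
        · exact i2 (Finset.mem_Icc.2 ⟨by omega, hv.2⟩)
      · omega
  have le_m : ∀ x, 1 ≤ x → x ≤ n → f x ≤ m := by
    intro x h1 h2
    by_cases h : f x = 1
    · omega
    have h3 := m4 x h1 h2 h
    have := anti m x le_rfl h3 h2
    omega
  have key2 : ∀ x, 1 ≤ x → x ≤ n → f x ≠ 1 → 2 * m ≤ x + f x ∧ (m - r) + 2 ≤ f x := by
    intro x h1 h2 h3
    have := bd x h1 h2
    have hl := le_m x h1 h2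
    obtain ⟨k1, k2⟩ := key (m - f x) x h1 h2 (by omega) (by omega)
    refine ⟨k1, ?_⟩
    have : insert 1 (Finset.Icc (f x) m) ⊆ im n f := by
      intro v hv
      rcases Finset.mem_insert.1 hv with rfl | hv
      · exact mem_im.2 ⟨1, ⟨le_rfl, by omega⟩, f1⟩
      · exact k2 hv
    have h5 := Finset.card_le_card this
    rw [Finset.card_insert_of_notMem (by simp; omega), Nat.card_Icc] at h5
    omega
  let al : ℕ → ℕ := fun x =>
    if ¬(1 ≤ x ∧ x ≤ n) then x else if f x = 1 then 1 else 2 * m - f x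
  have al1 : ∀ x, 1 ≤ x → x ≤ n → f x = 1 → al x = 1 := by
    intro x h1 h2 h3
    simp [al, h1, h2, h3]
  have al2 : ∀ x, 1 ≤ x → x ≤ n → f x ≠ 1 → al x = 2 * m - f x := by
    intro x h1 h2 h3
    simp [al, h1, h2, h3]
  have alb : ∀ x, 1 ≤ x → x ≤ n → 1 ≤ al x ∧ al x ≤ x := by
    intro x h1 h2
    by_cases h : f x = 1
    · rw [al1 x h1 h2 h]; omega
    · rw [al2 x h1 h2 h]
      have := key2 x h1 h2 h
      have := le_m x h1 h2
      omega
  have alD : al ∈ Dn n := by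
    refine ⟨⟨fun x h1 h2 => ?_, fun x hx => ?_⟩, fun x h1 h2 => (alb x h1 h2).2⟩
    · have := alb x h1 h2
      omega
    · simp only [al]
      rw [if_pos hx]
  have alC : Cy n al := by
    intro x y z hx hxy hyz hz
    by_cases hfz : f z = 1
    · right; exact al1 z (by omega) hz hfz
    left
    have qz := bd z (by omega) (by omega)
    have qy := alb y (by omega) (by omega)
    by_cases hfx : f x = 1
    · rw [al1 x (by omega) (by omega) hfx]
      omega
    have qx := m4 x (by omega) (by omega) hfx
    have r1 := anti x y qx hxy (by omega)
    have r2 := anti y z (by omega) hyz (by omega)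
    rw [al2 x (by omega) (by omega) hfx, al2 y (by omega) (by omega) (by omega)]
    omega
  have alI : (im n al).card ≤ (im n f).card := by
    apply im_card_le_of (p := fun v => if v = 1 then 1 else 2 * m - v)
    intro x h1 h2
    simp [al, h1, h2]
  have hl1 : lam n r m 1 = 1 := by
    unfold lam
    rw [if_neg (by omega), if_pos (by omega)]
  have : f = comp al (lam n r m) := by
    funext x
    simp only [comp]
    by_cases hx : 1 ≤ x ∧ x ≤ n
    · by_cases h : f x = 1
      · rw [al1 x hx.1 hx.2 h, hl1, h]
      · rw [al2 x hx.1 hx.2 h]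
        have := key2 x hx.1 hx.2 h
        have := le_m x hx.1 hx.2
        unfold lam
        rw [if_neg (by omega), if_neg (by omega), if_pos (by rw [le_min_iff]; omega)]
        omega
    · have e1 : al x = x := alD.1.2 x hx
      rw [e1, hf.1.2 x hx]
      unfold lam
      rw [if_pos hx]
  rw [this]
  exact gen.mul (gen_Cy hn hr hrn alD alC (alI.trans hc))
    (gen.base (Or.inr (Or.inr ⟨m, hm3, hmn, rfl⟩)))

lemma lam_ORDr {n r m : ℕ} (hn : 4 ≤ n) (hr : 3 ≤ r) (h3 : 3 ≤ m) (hm : m ≤ n - 1) :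
    lam n r m ∈ ORDr n r := by
  have hv : ∀ x, 1 ≤ x → x ≤ n → (x < m ∧ lam n r m x = 1) ∨
      (m ≤ x ∧ x ≤ 2 * m - (m - r) - 2 ∧ lam n r m x = 2 * m - x) ∨
      (2 * m - (m - r) - 2 < x ∧ m ≤ x ∧ lam n r m x = 1) := by
    intro x h1 h2
    unfold lam
    rw [if_neg (by omega)]
    by_cases ha : x < m
    · rw [if_pos ha]; omega
    · rw [if_neg ha]
      by_cases hb : x ≤ 2 * m - (m - r) - 2
      · rw [if_pos (by rw [le_min_iff]; omega)]; omega
      · rw [if_neg (by rw [le_min_iff]; omega)]; omega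
  have hD : lam n r m ∈ Dn n := by
    refine ⟨⟨fun x h1 h2 => ?_, fun x hx => ?_⟩, fun x h1 h2 => ?_⟩
    · have := hv x h1 h2
      omega
    · unfold lam
      rw [if_pos hx]
    · have := hv x h1 h2
      omega
  refine ⟨(mem_ORDn (by omega)).2 ⟨hD, Or.inr ?_⟩, ?_⟩
  · intro z x y hz hzx hxy hy
    have := hv x (by omega) (by omega)
    have := hv y (by omega) (by omega)
    have := hv z (by omega) (by omega)
    omega
  · have : im n (lam n r m) ⊆ insert 1 (Finset.Icc ((m - r) + 2) m) := by
      intro v hv'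
      obtain ⟨x, ⟨h1, h2⟩, rfl⟩ := mem_im.1 hv'
      rw [Finset.mem_insert, Finset.mem_Icc]
      have := hv x h1 h2
      omega
    have h5 := (Finset.card_le_card this).trans (Finset.card_insert_le _ _)
    rw [Nat.card_Icc] at h5
    omega

lemma lam_vals {n r m : ℕ} (hr : 3 ≤ r) (h3 : 3 ≤ m) (hm : m ≤ n - 1) :
    lam n r m m = m ∧ lam n r m (m + 1) = m - 1 := by
  unfold lam
  rw [if_neg (by omega), if_neg (by omega), if_pos (by rw [le_min_iff]; omega),
    if_neg (by omega), if_neg (by omega), if_pos (by rw [le_min_iff]; omega)]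
  omega

lemma Gs_sub {n r : ℕ} (hn : 4 ≤ n) (hr : 3 ≤ r) (hrn : r ≤ n - 1) : Gs n r ⊆ ORDr n r := by
  rintro f (⟨A, m, hv, hA, rfl⟩ | ⟨k, h1, h2, rfl⟩ | ⟨m, h1, h2, rfl⟩)
  · exact ee_ORDr (by omega) hv hA.le
  · exact ee_ORDr (by omega) (Val_Icc (by omega) (by omega)) (by simp; omega)
  · exact lam_ORDr hn hr h1 h2

lemma gen_Gs {n r : ℕ} (hn : 4 ≤ n) (hr : 3 ≤ r) (hrn : r ≤ n - 1) :
    {f | gen (Gs n r) f} = ORDr n r := by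
  ext f
  constructor
  · intro h
    exact gen_sub (Gs_sub hn hr hrn) (fun f hf g hg => ORDr_comp (by omega) hf hg) h
  · rintro ⟨h1, h2⟩
    obtain ⟨h3, h4 | h4⟩ := (mem_ORDn (by omega)).1 h1
    · exact gen_Cy hn hr hrn h3 h4 h2
    · exact gen_An hn hr hrn h3 h4 h2


lemma fix_factor {n : ℕ} {f g : ℕ → ℕ} (hf : f ∈ Dn n) (hg : g ∈ Dn n) {x : ℕ} (h1 : 1 ≤ x)
    (h2 : x ≤ n) (h : comp f g x = x) : f x = x ∧ g x = x := by
  simp only [comp] at h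
  have b := Dn_bd hf h1 h2
  have b' := Dn_bd hg b.1 b.2.2
  have : f x = x := by omega
  rw [this] at h
  exact ⟨this, h⟩

lemma irr_ee {n r m : ℕ} {A : Finset ℕ} (hv : Val n A m) (hA : A.card = r)
    {f g : ℕ → ℕ} (hf : f ∈ ORDr n r) (hg : g ∈ ORDr n r) (h : comp f g = ee n A m) :
    f = ee n A m := by
  have hfD := hf.1.1
  have hgD := hg.1.1
  have hmn := hv.2.2
  have fx : ∀ a ∈ A, f a = a ∧ g a = a := by
    intro a ha
    have := hv.2.1 a ha
    apply fix_factor hfD hgD (by omega) (by omega)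
    rw [h, ee_fix hv ha]
  have hsub : A ⊆ im n f := by
    intro a ha
    have := hv.2.1 a ha
    exact mem_im.2 ⟨a, by omega, (fx a ha).1⟩
  have heq : A = im n f := Finset.eq_of_subset_of_card_le hsub (by rw [hA]; exact hf.2)
  refine Dn_ext hfD (ee_Dn hv) fun x h1 h2 => ?_
  have hm : f x ∈ A := by
    rw [heq]
    exact mem_im.2 ⟨x, ⟨h1, h2⟩, rfl⟩
  rw [← h]
  exact (fx _ hm).2.symm

lemma eq_rho {n k : ℕ} (hk : 2 ≤ k) (hkn : k < n) {f : ℕ → ℕ} (hf : f ∈ ORDn n)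
    (h1 : ∀ x, 1 ≤ x → x ≤ k → f x = x) (h2 : f (k + 1) = 1) : f = ee n (Finset.Icc 1 k) k := by
  have hv : Val n (Finset.Icc 1 k) k := Val_Icc (by omega) (by omega)
  obtain ⟨hD, ho⟩ := (mem_ORDn (by omega)).1 hf
  refine Dn_ext hD (ee_Dn hv) fun x hx hxn => ?_
  by_cases hxk : x ≤ k
  · rw [h1 x hx hxk, ee_fix hv (by simp [hx, hxk])]
  · rw [ee_gt hx (by omega) hxn]
    rcases ho with ho | ho
    · have := ho k (k + 1) x (by omega) (by omega) (by omega) hxn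
      have := h1 k (by omega) le_rfl
      omega
    · have := ho 2 (k + 1) x (by omega) (by omega) (by omega) hxn
      have := h1 2 (by omega) (by omega)
      have := Dn_bd hD hx hxn
      omega

lemma irr_rho {n k : ℕ} (hk : 2 ≤ k) (hkn : k < n) {f g : ℕ → ℕ} (hf : f ∈ ORDn n)
    (hg : g ∈ ORDn n) (h : comp f g = ee n (Finset.Icc 1 k) k) :
    f = ee n (Finset.Icc 1 k) k ∨ g = ee n (Finset.Icc 1 k) k := by
  have hv : Val n (Finset.Icc 1 k) k := Val_Icc (by omega) (by omega)
  have fx : ∀ a, 1 ≤ a → a ≤ k → f a = a ∧ g a = a := by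
    intro a h1 h2
    apply fix_factor hf.1 hg.1 h1 (by omega)
    rw [h, ee_fix hv (by simp [h1, h2])]
  have h1 : g (f (k + 1)) = 1 := by
    have : comp f g (k + 1) = 1 := by rw [h, ee_gt (by omega) (by omega) (by omega)]
    exact this
  have b := Dn_bd hf.1 (x := k + 1) (by omega) (by omega)
  by_cases h2 : f (k + 1) = k + 1
  · right
    rw [h2] at h1
    exact eq_rho hk hkn hg (fun x p q => (fx x p q).2) h1
  · left
    have := (fx (f (k + 1)) b.1 (by omega)).2
    exact eq_rho hk hkn hf (fun x p q => (fx x p q).1) (by omega)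

/-- The class of maps that behave like `lam n r m`. -/
def Tm (m : ℕ) (f : ℕ → ℕ) : Prop := f m = m ∧ f (m + 1) = m - 1

lemma Tm_low {n m : ℕ} (h3 : 3 ≤ m) (hm : m ≤ n - 1) {f : ℕ → ℕ} (hf : f ∈ ORDn n)
    (h : Tm m f) {x : ℕ} (h1 : 1 ≤ x) (h2 : x < m) : f x = 1 := by
  obtain ⟨hD, ho⟩ := (mem_ORDn (by omega)).1 hf
  obtain ⟨t1, t2⟩ := h
  rcases ho with ho | ho
  · have := ho m (m + 1) (m + 1) (by omega) (by omega) (by omega) (by omega)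
    omega
  · have := ho x x m (by omega) (by omega) (by omega) (by omega)
    have := Dn_bd hD (x := x) (by omega) (by omega)
    omega

lemma irr_Tm {n m : ℕ} (hm3 : 3 ≤ m) (hm : m ≤ n - 1) {f g : ℕ → ℕ} (hf : f ∈ ORDn n)
    (hg : g ∈ ORDn n) (h : Tm m (comp f g)) : Tm m f ∨ Tm m g := by
  obtain ⟨t1, t2⟩ := h
  obtain ⟨f1, g1⟩ := fix_factor hf.1 hg.1 (by omega) (by omega) t1
  simp only [comp] at t2
  have b := Dn_bd hf.1 (x := m + 1) (by omega) (by omega)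
  have b' := Dn_bd hg.1 b.1 b.2.2
  by_cases h1 : f (m + 1) = m + 1
  · right
    rw [h1] at t2
    exact ⟨g1, t2⟩
  · left
    refine ⟨f1, ?_⟩
    by_contra h2
    have h3 : f (m + 1) = m := by omega
    rw [h3] at t2
    omega

lemma hockey (n s : ℕ) : ∑ m ∈ Finset.Icc 1 n, Nat.choose (m - 1) s = Nat.choose n (s + 1) := by
  induction n with
  | zero => simp
  | succ n ih =>
    rw [Finset.sum_Icc_succ_top (by omega), ih, Nat.choose_succ_succ]
    simp [add_comm]

/-- Index set of the idempotent generators. -/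
def idx (n r : ℕ) : Finset (Σ _ : ℕ, Finset ℕ) :=
  (Finset.Icc 1 n).sigma fun m => Finset.powersetCard (r - 1) (Finset.Icc 2 m)

lemma idx_card {n r : ℕ} (hr : 1 ≤ r) : (idx n r).card = Nat.choose n r := by
  unfold idx
  rw [Finset.card_sigma]
  obtain ⟨s, rfl⟩ : ∃ s, r = s + 1 := ⟨r - 1, by omega⟩
  rw [← hockey]
  apply Finset.sum_congr rfl
  intro m _
  rw [Finset.card_powersetCard, Nat.card_Icc]
  rfl

lemma idx_val {n r : ℕ} (hr : 1 ≤ r) {p : Σ _ : ℕ, Finset ℕ} (hp : p ∈ idx n r) :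
    Val n (insert 1 p.2) p.1 ∧ (insert 1 p.2).card = r ∧ 1 ∉ p.2 := by
  obtain ⟨m, A⟩ := p
  simp only [idx, Finset.mem_sigma, Finset.mem_Icc, Finset.mem_powersetCard] at hp
  obtain ⟨⟨h1, h2⟩, h3, h4⟩ := hp
  have h5 : 1 ∉ A := fun h => by
    have := Finset.mem_Icc.1 (h3 h)
    omega
  refine ⟨⟨by simp, fun a ha => ?_, h2⟩, ?_, h5⟩
  · rcases Finset.mem_insert.1 ha with rfl | ha
    · exact ⟨le_rfl, h1⟩
    · have := Finset.mem_Icc.1 (h3 ha)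
      change 1 ≤ a ∧ a ≤ m
      omega
  · rw [Finset.card_insert_of_notMem h5, h4]
    omega

lemma idx_mem {n r m : ℕ} {A : Finset ℕ} (hv : Val n A m) (hA : A.card = r) :
    (⟨m, A.erase 1⟩ : Σ _ : ℕ, Finset ℕ) ∈ idx n r := by
  simp only [idx, Finset.mem_sigma, Finset.mem_Icc, Finset.mem_powersetCard]
  refine ⟨⟨(hv.2.1 1 hv.1).2, hv.2.2⟩, fun a ha => ?_, ?_⟩
  · rw [Finset.mem_erase] at ha
    have := hv.2.1 a ha.2
    rw [Finset.mem_Icc]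
    omega
  · rw [Finset.card_erase_of_mem hv.1, hA]

lemma ee_m_le {n m m' : ℕ} {A : Finset ℕ} (hv : Val n A m) (hv' : Val n A m')
    (hA : 2 ≤ A.card) (h : ee n A m = ee n A m') : m ≤ m' := by
  by_contra hlt
  have hmn := hv.2.2
  obtain ⟨a, ha, ha1⟩ := Finset.exists_mem_ne (by omega : 1 < A.card) 1
  have h1 := hv.2.1 a ha
  have h2 := (ee_spec hv (x := m) (by omega) le_rfl).2.2 a ha h1.2
  rw [h, ee_gt (by omega) (by omega) hmn] at h2
  omega

lemma ee_inj {n r : ℕ} (hr : 2 ≤ r) :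
    Set.InjOn (fun p : Σ _ : ℕ, Finset ℕ => ee n (insert 1 p.2) p.1) (idx n r) := by
  intro p hp q hq h
  obtain ⟨v1, c1, n1⟩ := idx_val (by omega) hp
  obtain ⟨v2, c2, n2⟩ := idx_val (by omega) hq
  obtain ⟨m, A⟩ := p
  obtain ⟨m', A'⟩ := q
  simp only at h v1 v2 c1 c2 n1 n2
  have hAA : insert 1 A = insert 1 A' := by rw [← ee_im v1, ← ee_im v2, h]
  have hA : A = A' := by
    rw [← Finset.erase_insert n1, ← Finset.erase_insert n2, hAA]
  subst hA
  have h1 := ee_m_le v1 v2 (by omega) h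
  have h2 := ee_m_le v2 v1 (by omega) h.symm
  have : m = m' := by omega
  subst this
  rfl

lemma Gs_card {n r : ℕ} (hn : 4 ≤ n) (hr : 3 ≤ r) :
    (Gs n r).Finite ∧ (Gs n r).ncard ≤ Nat.choose n r + n + r - 5 := by
  classical
  let F : Finset (ℕ → ℕ) :=
    ((idx n r).image fun p : Σ _ : ℕ, Finset ℕ => ee n (insert 1 p.2) p.1) ∪
    ((Finset.Icc 2 (r - 1)).image fun k => ee n (Finset.Icc 1 k) k) ∪
    ((Finset.Icc 3 (n - 1)).image fun m => lam n r m)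
  have hsub : Gs n r ⊆ (F : Set (ℕ → ℕ)) := by
    rintro f (⟨A, m, hv, hA, rfl⟩ | ⟨k, h1, h2, rfl⟩ | ⟨m, h1, h2, rfl⟩)
    · simp only [F, Finset.mem_coe, Finset.mem_union]
      refine Or.inl (Or.inl (Finset.mem_image.2 ⟨_, idx_mem hv hA, ?_⟩))
      simp only [Finset.insert_erase hv.1]
    · simp only [F, Finset.mem_coe, Finset.mem_union]
      exact Or.inl (Or.inr (Finset.mem_image.2 ⟨k, Finset.mem_Icc.2 (by omega), rfl⟩))
    · simp only [F, Finset.mem_coe, Finset.mem_union]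
      exact Or.inr (Finset.mem_image.2 ⟨m, Finset.mem_Icc.2 (by omega), rfl⟩)
  refine ⟨F.finite_toSet.subset hsub, ?_⟩
  have h1 := Set.ncard_le_ncard hsub F.finite_toSet
  rw [Set.ncard_coe_finset] at h1
  have h2 : F.card ≤ (idx n r).card + (Finset.Icc 2 (r - 1)).card + (Finset.Icc 3 (n - 1)).card :=
    (Finset.card_union_le _ _).trans (Nat.add_le_add ((Finset.card_union_le _ _).trans
      (Nat.add_le_add Finset.card_image_le Finset.card_image_le)) Finset.card_image_le)
  rw [idx_card (by omega), Nat.card_Icc, Nat.card_Icc] at h2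
  omega

lemma lower {n r : ℕ} (hn : 4 ≤ n) (hr : 3 ≤ r) (hrn : r ≤ n - 1) {A : Set (ℕ → ℕ)}
    (hA : A ⊆ ORDr n r) (hfin : A.Finite) (hgen : {f | gen A f} = ORDr n r) :
    Nat.choose n r + n + r - 5 ≤ A.ncard := by
  classical
  have hS : ∀ f ∈ ORDr n r, ∀ g ∈ ORDr n r, comp f g ∈ ORDr n r :=
    fun f hf g hg => ORDr_comp (by omega) hf hg
  have hg : ∀ f ∈ ORDr n r, gen A f := fun f hf => by rw [← hgen] at hf; exact hf
  have hE : ∀ p ∈ idx n r, ee n (insert 1 p.2) p.1 ∈ A := by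
    intro p hp
    obtain ⟨v, c, -⟩ := idx_val (by omega) hp
    obtain ⟨a, ha, h⟩ := gen_hit hA hS (fun f => f = ee n (insert 1 p.2) p.1)
      (fun f hf g hg h => Or.inl (irr_ee v c hf hg h)) (hg _ (ee_ORDr (by omega) v c.le)) rfl
    exact h ▸ ha
  have hR : ∀ k ∈ Finset.Icc 2 (r - 1), ee n (Finset.Icc 1 k) k ∈ A := by
    intro k hk
    rw [Finset.mem_Icc] at hk
    obtain ⟨a, ha, h⟩ := gen_hit hA hS (fun f => f = ee n (Finset.Icc 1 k) k)
      (fun f hf g hg h => irr_rho hk.1 (by omega) hf.1 hg.1 h)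
      (hg _ (ee_ORDr (by omega) (Val_Icc (by omega) (by omega)) (by simp; omega))) rfl
    exact h ▸ ha
  have hT : ∀ m, ∃ a, 3 ≤ m → m ≤ n - 1 → a ∈ A ∧ Tm m a := by
    intro m
    by_cases hm : 3 ≤ m ∧ m ≤ n - 1
    · obtain ⟨a, ha, h⟩ := gen_hit hA hS (Tm m)
        (fun f hf g hg h => irr_Tm hm.1 hm.2 hf.1 hg.1 h)
        (hg _ (lam_ORDr hn hr hm.1 hm.2)) (lam_vals hr hm.1 hm.2)
      exact ⟨a, fun _ _ => ⟨ha, h⟩⟩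
    · exact ⟨id, fun h1 h2 => absurd ⟨h1, h2⟩ hm⟩
  choose t ht using hT
  let E : Finset (ℕ → ℕ) := (idx n r).image fun p : Σ _ : ℕ, Finset ℕ => ee n (insert 1 p.2) p.1
  let R : Finset (ℕ → ℕ) := (Finset.Icc 2 (r - 1)).image fun k => ee n (Finset.Icc 1 k) k
  let T : Finset (ℕ → ℕ) := (Finset.Icc 3 (n - 1)).image t
  have cE : E.card = Nat.choose n r := by
    rw [Finset.card_image_of_injOn (ee_inj (by omega)), idx_card (by omega)]
  have cR : R.card = r - 2 := by
    rw [Finset.card_image_of_injOn, Nat.card_Icc]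
    · omega
    · intro k hk l hl h
      rw [Finset.mem_coe, Finset.mem_Icc] at hk hl
      have h1 : (im n (ee n (Finset.Icc 1 k) k)).card = (im n (ee n (Finset.Icc 1 l) l)).card := by
        simp only at h
        rw [h]
      rw [ee_im (Val_Icc (by omega) (by omega)), ee_im (Val_Icc (by omega) (by omega)),
        Nat.card_Icc, Nat.card_Icc] at h1
      omega
  have cT : T.card = n - 3 := by
    rw [Finset.card_image_of_injOn, Nat.card_Icc]
    · omega
    · have key : ∀ k l, 3 ≤ k → k < l → l ≤ n - 1 → t k ≠ t l := by
        intro k l hk hkl hl h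
        obtain ⟨a1, a2⟩ := ht k hk (by omega)
        obtain ⟨b1, b2⟩ := ht l (by omega) hl
        have := Tm_low (by omega) hl (hA b1).1 b2 (x := k) (by omega) hkl
        rw [← h, a2.1] at this
        omega
      intro k hk l hl h
      rw [Finset.mem_coe, Finset.mem_Icc] at hk hl
      by_contra hne
      rcases Nat.lt_or_gt_of_ne hne with h' | h'
      · exact key k l hk.1 h' hl.2 h
      · exact key l k hl.1 h' hk.2 h.symm
  have dER : Disjoint E R := by
    rw [Finset.disjoint_left]
    intro f h1 h2
    obtain ⟨p, hp, rfl⟩ := Finset.mem_image.1 h1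
    obtain ⟨k, hk, h⟩ := Finset.mem_image.1 h2
    rw [Finset.mem_Icc] at hk
    obtain ⟨v, c, -⟩ := idx_val (by omega) hp
    have h3 : (im n (ee n (Finset.Icc 1 k) k)).card = r := by
      rw [h, ee_im v, c]
    rw [ee_im (Val_Icc (by omega) (by omega)), Nat.card_Icc] at h3
    omega
  have notT : ∀ B m, Val n B m → ee n B m ∉ T := by
    intro B m hv hmem
    obtain ⟨k, hk, h⟩ := Finset.mem_image.1 hmem
    rw [Finset.mem_Icc] at hk
    obtain ⟨a1, a2⟩ := ht k hk.1 hk.2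
    have l1 := Tm_low hk.1 hk.2 (hA a1).1 a2 (x := k - 1) (by omega) (by omega)
    have l2 := a2.2
    rw [h] at l1 l2
    have := ee_idem hv (x := k + 1) (by omega) (by omega)
    rw [l2, l1] at this
    omega
  have dT : Disjoint (E ∪ R) T := by
    rw [Finset.disjoint_left]
    intro f h1
    rcases Finset.mem_union.1 h1 with h1 | h1
    · obtain ⟨p, hp, rfl⟩ := Finset.mem_image.1 h1
      exact notT _ _ (idx_val (by omega) hp).1
    · obtain ⟨k, hk, rfl⟩ := Finset.mem_image.1 h1
      rw [Finset.mem_Icc] at hk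
      exact notT _ _ (Val_Icc (by omega) (by omega))
  have hsub : ((E ∪ R ∪ T : Finset (ℕ → ℕ)) : Set (ℕ → ℕ)) ⊆ A := by
    intro f hf
    rw [Finset.mem_coe, Finset.mem_union, Finset.mem_union] at hf
    rcases hf with (h | h) | h
    · obtain ⟨p, hp, rfl⟩ := Finset.mem_image.1 h
      exact hE p hp
    · obtain ⟨k, hk, rfl⟩ := Finset.mem_image.1 h
      exact hR k hk
    · obtain ⟨k, hk, rfl⟩ := Finset.mem_image.1 h
      rw [Finset.mem_Icc] at hk
      exact (ht k hk.1 hk.2).1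
  have h1 := Set.ncard_le_ncard hsub hfin
  rw [Set.ncard_coe_finset, Finset.card_union_of_disjoint dT, Finset.card_union_of_disjoint dER,
    cE, cR, cT] at h1
  omega

lemma rank_eq {S : Set (ℕ → ℕ)} {N : ℕ}
    (hu : ∃ A : Set (ℕ → ℕ), A ⊆ S ∧ A.Finite ∧ A.ncard ≤ N ∧ {f | gen A f} = S)
    (hl : ∀ A : Set (ℕ → ℕ), A ⊆ S → A.Finite → {f | gen A f} = S → N ≤ A.ncard) :
    rank S = N := by
  obtain ⟨A, h1, h2, h3, h4⟩ := hu
  have h5 := hl A h1 h2 h4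
  apply le_antisymm
  · exact Nat.sInf_le ⟨A, h1, h2, by omega, h4⟩
  · have hne : {k | ∃ A : Set (ℕ → ℕ), A ⊆ S ∧ A.Finite ∧ A.ncard = k ∧
        {f | gen A f} = S}.Nonempty := ⟨_, A, h1, h2, rfl, h4⟩
    obtain ⟨B, b1, b2, b3, b4⟩ := Nat.sInf_mem hne
    have := hl B b1 b2 b4
    unfold rank
    omega

lemma id_ORDn {n : ℕ} (hn : 1 ≤ n) : (id : ℕ → ℕ) ∈ ORDn n :=
  (mem_ORDn hn).2 ⟨⟨⟨fun _ h1 h2 => ⟨h1, h2⟩, fun _ _ => rfl⟩, fun _ _ _ => le_rfl⟩,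
    Or.inl fun _ _ _ _ h _ _ => Or.inl h⟩

lemma ORDn_cases {n : ℕ} {f : ℕ → ℕ} (hf : f ∈ ORDn n) :
    f = id ∨ f ∈ ORDr n (n - 1) := by
  by_cases h : (im n f).card ≤ n - 1
  · exact Or.inr ⟨hf, h⟩
  left
  have hD := hf.1
  have hsub : im n f ⊆ Finset.Icc 1 n := by
    intro v hv
    obtain ⟨x, ⟨h1, h2⟩, rfl⟩ := mem_im.1 hv
    exact Finset.mem_Icc.2 (hD.1.1 x h1 h2)
  have hinj : Set.InjOn f (Finset.Icc 1 n : Finset ℕ) := by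
    apply Finset.card_image_iff.1
    have h1 : (Finset.image f (Finset.Icc 1 n)).card ≤ (Finset.Icc 1 n).card :=
      Finset.card_image_le
    have h2 : ¬ (Finset.image f (Finset.Icc 1 n)).card ≤ n - 1 := h
    rw [Nat.card_Icc] at *
    omega
  have key : ∀ x, 1 ≤ x → x ≤ n → f x = x := by
    intro x
    induction x using Nat.strong_induction_on with
    | _ x ih =>
      intro h1 h2
      have b := Dn_bd hD h1 h2
      by_contra hne
      have h3 := ih (f x) (by omega) b.1 b.2.2
      have := hinj (by simpa using ⟨b.1, b.2.2⟩) (by simpa using ⟨h1, h2⟩) h3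
      omega
  funext x
  by_cases hx : 1 ≤ x ∧ x ≤ n
  · exact key x hx.1 hx.2
  · exact hD.1.2 x hx

lemma id_notMem {n : ℕ} (hn : 1 ≤ n) : (id : ℕ → ℕ) ∉ ORDr n (n - 1) := by
  rintro ⟨-, h⟩
  simp [im] at h
  omega

lemma id_irr {n : ℕ} {f g : ℕ → ℕ} (hf : f ∈ ORDn n) (hg : g ∈ ORDn n) (h : comp f g = id) :
    f = id ∧ g = id := by
  have key : ∀ x, 1 ≤ x → x ≤ n → f x = x ∧ g x = x := fun x h1 h2 =>
    fix_factor hf.1 hg.1 h1 h2 (by rw [h]; rfl)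
  constructor
  · funext x
    by_cases hx : 1 ≤ x ∧ x ≤ n
    · exact (key x hx.1 hx.2).1
    · exact hf.1.1.2 x hx
  · funext x
    by_cases hx : 1 ≤ x ∧ x ≤ n
    · exact (key x hx.1 hx.2).2
    · exact hg.1.1.2 x hx

lemma gen_drop {A : Set (ℕ → ℕ)} {f : ℕ → ℕ} (h : gen A f) : f = id ∨ gen (A \ {id}) f := by
  induction h with
  | @base f h =>
    by_cases hf : f = id
    · exact Or.inl hf
    · exact Or.inr (gen.base ⟨h, hf⟩)
  | @mul f g _ _ h1 h2 =>
    rcases h1 with rfl | h1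
    · exact h2
    · rcases h2 with rfl | h2
      · exact Or.inr h1
      · exact Or.inr (gen.mul h1 h2)

theorem rank_ordr (n r : ℕ) (hn : 4 ≤ n) (hr : 3 ≤ r) (hrn : r ≤ n - 1) :
    rank (ORDr n r) = Nat.choose n r + n + r - 5 ∧ rank (ORDn n) = 3 * n - 5 := by
  constructor
  · apply rank_eq
    · exact ⟨Gs n r, Gs_sub hn hr hrn, (Gs_card hn hr).1, (Gs_card hn hr).2, gen_Gs hn hr hrn⟩
    · exact fun A h1 h2 h3 => lower hn hr hrn h1 h2 h3
  · have hch : Nat.choose n (n - 1) = n := by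
      rw [Nat.choose_symm (by omega : 1 ≤ n), Nat.choose_one_right]
    have hS : ∀ f ∈ ORDn n, ∀ g ∈ ORDn n, comp f g ∈ ORDn n :=
      fun f hf g hg => ORDn_comp (by omega) hf hg
    have hS' : ∀ f ∈ ORDr n (n - 1), ∀ g ∈ ORDr n (n - 1), comp f g ∈ ORDr n (n - 1) :=
      fun f hf g hg => ORDr_comp (by omega) hf hg
    apply rank_eq
    · obtain ⟨c1, c2⟩ := Gs_card (r := n - 1) hn (by omega)
      have hsub : insert id (Gs n (n - 1)) ⊆ ORDn n := by
        intro f hf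
        rcases Set.mem_insert_iff.1 hf with rfl | hf
        · exact id_ORDn (by omega)
        · exact (Gs_sub hn (by omega) le_rfl hf).1
      refine ⟨insert id (Gs n (n - 1)), hsub, c1.insert _, ?_, ?_⟩
      · have := Set.ncard_insert_le (id : ℕ → ℕ) (Gs n (n - 1))
        omega
      · ext f
        constructor
        · exact fun h => gen_sub hsub hS h
        · intro h
          rcases ORDn_cases h with rfl | h
          · exact gen.base (Set.mem_insert _ _)
          · rw [← gen_Gs hn (by omega) le_rfl] at h
            exact gen_mono (Set.subset_insert _ _) h
    · intro A hA hfin hgen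
      have hidm : id ∈ A := by
        have h0 : gen A id := by
          have := id_ORDn (n := n) (by omega)
          rw [← hgen] at this
          exact this
        obtain ⟨a, ha, h⟩ := gen_hit hA hS (fun f => f = id)
          (fun f hf g hg h => Or.inl (id_irr hf hg h).1) h0 rfl
        exact h ▸ ha
      have hsub : A \ {id} ⊆ ORDr n (n - 1) := by
        intro f hf
        rcases ORDn_cases (hA hf.1) with h | h
        · exact absurd h hf.2
        · exact h
      have hg : {f | gen (A \ {id}) f} = ORDr n (n - 1) := by
        ext f
        constructor
        · exact fun h => gen_sub hsub hS' h
        · intro h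
          have h1 : f ∈ {f | gen A f} := by
            rw [hgen]
            exact h.1
          rcases gen_drop h1 with rfl | h2
          · exact absurd h (id_notMem (by omega))
          · exact h2
      have h1 := lower hn (by omega) le_rfl hsub (hfin.subset Set.sdiff_subset) hg
      have h2 := Set.ncard_sdiff_singleton_add_one hidm hfin
      omega

end ORDPaper
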